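/- For every α ∈ (0,1) and every x > 1, the derivative of the profile function Φ satisfies |Φ′(x)| ≤ C_1(α)/x, where C_1(α) = α·2^{1+α}·max{ ∫_{1/2}^1 u^{−(1+α)}(1−u)^{α−1} du , 2 }. -/

import Mathlib

open Real MeasureTheory Set Filter Topology

noncomputable def bCoef (α : ℝ) (n : ℕ) : ℝ :=
  ∏ i ∈ Finset.range n, Real.Gamma (α * i + i + 2) / Real.Gamma (α * (i + 1) + i + 2)

/-- The profile function `Φ(x) = ∑ bₙ (−x^{1+α}/(1+α))ⁿ`. -/
noncomputable def Phi (α : ℝ) (x : ℝ) : ℝ :=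
  ∑' n : ℕ, bCoef α n * (-(x ^ (1 + α)) / (1 + α)) ^ n

/-- The Caputo fractional derivative of order `α`. -/
noncomputable def caputo (α : ℝ) (f : ℝ → ℝ) (x : ℝ) : ℝ :=
  (1 / Real.Gamma (1 - α)) * ∫ τ in (0:ℝ)..x, deriv f τ * (x - τ) ^ (-α)

/-- The normalizing constant `a₀` with `1/a₀ = 2∫₀^∞ Φ`. -/
noncomputable def a0 (α : ℝ) : ℝ := (2 * ∫ x in Set.Ioi (0:ℝ), Phi α x)⁻¹

/-- The fundamental solution `𝔈_t(x) = a₀ t^{−1/(1+α)} Φ(|x| t^{−1/(1+α)})`. -/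
noncomputable def fundSol (α t x : ℝ) : ℝ :=
  a0 α * t ^ (-1/(1+α)) * Phi α (|x| * t ^ (-1/(1+α)))

noncomputable def C1 (α : ℝ) : ℝ :=
  α * (2:ℝ) ^ (1+α) * max (∫ u in (1/2:ℝ)..1, u ^ (-(1+α)) * (1-u) ^ (α-1)) 2

noncomputable def C2 (α : ℝ) : ℝ := 2 * a0 α * C1 α

open ProbabilityTheory

lemma aux_beta_int {a c : ℝ} (ha : 0 < a) (hc : 0 < c) : ∫ x, betaPDFReal a c x = 1 := by
  rw [integral_eq_lintegral_of_nonneg_ae]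
  · have := lintegral_betaPDF_eq_one ha hc
    unfold betaPDF at this
    rw [this]; simp
  · refine Eventually.of_forall fun x => ?_
    by_cases h : 0 < x ∧ x < 1
    · exact (betaPDFReal_pos h.1 h.2 ha hc).le
    · simp [betaPDFReal, h]
  · exact (measurable_betaPDFReal a c).aestronglyMeasurable

lemma aux_beta_ratio {a c : ℝ} (ha : 0 < a) (hc : 0 < c) (n : ℕ) :
    beta (a + n) c / beta a c = ∏ i ∈ Finset.range n, (a + i) / (a + c + i) := by
  induction n with
  | zero => simp [(beta_pos ha hc).ne']
  | succ n ih =>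
    rw [Finset.prod_range_succ, ← ih]
    have h1 : Real.Gamma (a + (n + 1 : ℕ)) = (a + n) * Real.Gamma (a + n) := by
      rw [← Real.Gamma_add_one (by positivity)]; push_cast; ring_nf
    have h2 : Real.Gamma (a + (n + 1 : ℕ) + c) = (a + c + n) * Real.Gamma (a + n + c) := by
      rw [show a + c + n = a + n + c by ring, ← Real.Gamma_add_one (by positivity)]
      push_cast; ring_nf
    have h3 : 0 < Real.Gamma (a + n + c) := Real.Gamma_pos_of_pos (by positivity)
    have h4 := beta_pos ha hc
    have h5 : 0 < a + c + n := by positivity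
    unfold beta at h4 ⊢
    rw [h1, h2]
    generalize Real.Gamma a * Real.Gamma c / Real.Gamma (a + c) = B at *
    field_simp

lemma aux_beta_moment {a c : ℝ} (ha : 0 < a) (hc : 0 < c) (n : ℕ) :
    ∫ t, t ^ n ∂(betaMeasure a c) = ∏ i ∈ Finset.range n, (a + i) / (a + c + i) := by
  rw [← aux_beta_ratio ha hc, betaMeasure, integral_withDensity_eq_integral_toReal_smul]
  · have : ∀ x, (betaPDF a c x).toReal • x ^ n
        = (beta (a + n) c / beta a c) * betaPDFReal (a + n) c x := by
      intro x
      by_cases h : 0 < x ∧ x < 1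
      · rw [betaPDF, ENNReal.toReal_ofReal (betaPDFReal_pos h.1 h.2 ha hc).le]
        simp only [betaPDFReal, h, and_self, if_true, smul_eq_mul]
        rw [show a + n - 1 = (a - 1) + n by ring, Real.rpow_add_natCast h.1.ne']
        have h4 := beta_pos ha hc
        have h5 : 0 < beta (a + n) c := beta_pos (by positivity) hc
        field_simp
      · simp [betaPDF, betaPDFReal, h]
    simp_rw [this]
    rw [integral_const_mul, aux_beta_int (by positivity) hc, mul_one]
  · unfold betaPDF; fun_prop
  · exact Eventually.of_forall fun x => by simp [betaPDF]

lemma aux_beta_supp (a c : ℝ) : ∀ᵐ t ∂(betaMeasure a c), t ∈ Icc (0:ℝ) 1 := by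
  rw [betaMeasure, ae_withDensity_iff (by unfold betaPDF; fun_prop)]
  refine Eventually.of_forall fun x hx => ?_
  by_contra h
  apply hx
  have : ¬ (0 < x ∧ x < 1) := fun h' => h ⟨h'.1.le, h'.2.le⟩
  simp [betaPDF, betaPDFReal, this]

lemma aux_mix (μ : Measure ℝ) [IsProbabilityMeasure μ] (h01 : ∀ᵐ t ∂μ, t ∈ Icc (0:ℝ) 1)
    (m d : ℕ → ℝ) (hm : ∀ n, ∫ t, t ^ n ∂μ = m n)
    (hs : ∀ z : ℝ, Summable fun n => |d n| * |z| ^ n)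
    (hb : ∀ z : ℝ, 0 ≤ z → |∑' n, d n * (-z) ^ n| ≤ 1) (z : ℝ) (hz : 0 ≤ z) :
    |∑' n, d n * m n * (-z) ^ n| ≤ 1 := by
  have hle : ∀ n : ℕ, ∀ᵐ t ∂μ, ‖d n * (-(z * t)) ^ n‖ ≤ |d n| * |z| ^ n := by
    intro n
    filter_upwards [h01] with t ht
    rw [norm_mul, norm_pow, norm_neg, norm_mul, Real.norm_eq_abs, Real.norm_eq_abs,
      Real.norm_eq_abs, abs_of_nonneg ht.1]
    have h0 := mul_nonneg (abs_nonneg z) ht.1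
    have h1 := mul_le_of_le_one_right (abs_nonneg z) ht.2
    gcongr
  have hint : ∀ n : ℕ, Integrable (fun t => d n * (-(z * t)) ^ n) μ := fun n =>
    Integrable.mono' (integrable_const (|d n| * |z| ^ n))
      (Measurable.aestronglyMeasurable (by fun_prop)) (hle n)
  have hsum : Summable fun n => ∫ t, ‖d n * (-(z * t)) ^ n‖ ∂μ := by
    refine Summable.of_nonneg_of_le (fun n => integral_nonneg fun t => norm_nonneg _)
      (fun n => ?_) (hs z)
    calc _ ≤ ∫ t, |d n| * |z| ^ n ∂μ :=
          integral_mono_ae (hint n).norm (integrable_const _) (hle n)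
      _ = _ := by simp
  have key := (hasSum_integral_of_summable_integral_norm hint hsum).tsum_eq
  have e : ∀ n : ℕ, ∫ t, d n * (-(z * t)) ^ n ∂μ = d n * m n * (-z) ^ n := by
    intro n
    rw [← hm n, integral_const_mul]
    simp_rw [show ∀ t : ℝ, (-(z * t)) ^ n = (-z) ^ n * t ^ n from fun t => by
      rw [← mul_pow]; ring]
    rw [integral_const_mul]; ring
  simp_rw [e] at key
  rw [key, ← Real.norm_eq_abs]
  have := norm_integral_le_of_norm_le_const (μ := μ) (C := 1)
    (f := fun t => ∑' n, d n * (-(z * t)) ^ n) (by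
      filter_upwards [h01] with t ht
      exact hb _ (mul_nonneg hz ht.1))
  simpa using this

lemma aux_summ_fact (z : ℝ) : Summable fun n : ℕ => (n : ℝ) / n.factorial * |z| ^ n := by
  rw [← summable_nat_add_iff 1]
  refine ((Real.summable_pow_div_factorial |z|).mul_left |z|).congr fun n => ?_
  rw [Nat.factorial_succ]; push_cast; field_simp; ring

lemma aux_base (z : ℝ) (hz : 0 ≤ z) : |∑' n : ℕ, (n : ℝ) / n.factorial * (-z) ^ n| ≤ 1 := by
  have hs : Summable fun n : ℕ => (n : ℝ) / n.factorial * (-z) ^ n := by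
    refine Summable.of_norm ((aux_summ_fact z).congr fun n => ?_)
    rw [norm_mul, norm_pow, norm_neg, Real.norm_eq_abs, Real.norm_eq_abs,
      abs_of_nonneg (show (0:ℝ) ≤ (n : ℝ) / n.factorial by positivity)]
  have : ∑' n : ℕ, (n : ℝ) / n.factorial * (-z) ^ n = -z * Real.exp (-z) := by
    rw [hs.tsum_eq_zero_add, Real.exp_eq_exp_ℝ, NormedSpace.exp_eq_tsum_div, ← tsum_mul_left]
    simp only [Nat.cast_zero, zero_div, zero_mul, zero_add]
    congr 1; ext n
    rw [Nat.factorial_succ]; push_cast; field_simp; ring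
  rw [this, abs_mul, abs_neg, abs_of_nonneg hz, Real.abs_exp, Real.exp_neg]
  have := Real.add_one_le_exp z
  rw [← div_eq_mul_inv, div_le_one (Real.exp_pos _)]; linarith

lemma aux_step (a : ℕ → ℝ) (c : ℝ) (ha : ∀ k, 0 < a k) (hc : 0 < c) (N : ℕ) :
    ∀ z : ℝ, 0 ≤ z → |∑' n : ℕ, ((n : ℝ) / n.factorial *
      ∏ i ∈ Finset.range n, ∏ k ∈ Finset.range N, (a k + i) / (a k + c + i)) * (-z) ^ n| ≤ 1 := by
  induction N with
  | zero => simpa using aux_base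
  | succ N ih =>
    intro z hz
    have := isProbabilityMeasureBeta (ha N) hc
    have := aux_mix (betaMeasure (a N) c) (aux_beta_supp _ _)
      (fun n => ∏ i ∈ Finset.range n, (a N + i) / (a N + c + i)) _
      (fun n => aux_beta_moment (ha N) hc n) ?_ ih z hz
    · simp_rw [Finset.prod_range_succ _ N, Finset.prod_mul_distrib]
      simpa only [mul_assoc] using this
    · intro z
      refine Summable.of_nonneg_of_le (fun n => by positivity) (fun n => ?_) (aux_summ_fact z)
      gcongr
      rw [abs_of_nonneg]
      · refine mul_le_of_le_one_right (by positivity) ?_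
        refine Finset.prod_le_one (fun i _ => Finset.prod_nonneg fun k _ => ?_)
          (fun i _ => Finset.prod_le_one (fun k _ => ?_) fun k _ => ?_)
        · have := ha k; positivity
        · have := ha k; positivity
        · have := ha k
          rw [div_le_one (by positivity)]; linarith
      · refine mul_nonneg (by positivity) (Finset.prod_nonneg fun i _ => Finset.prod_nonneg fun k _ => ?_)
        have := ha k; positivity

lemma aux_G2 {w θ : ℝ} (hw : 0 < w) (h0 : 0 < θ) (h1 : θ < 1) :
    Real.Gamma (w + θ) ≤ Real.Gamma w * w ^ θ := by
  have := Real.Gamma_mul_add_mul_le_rpow_Gamma_mul_rpow_Gamma (s := w) (t := w + 1)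
    (a := 1 - θ) (b := θ) hw (by linarith) (by linarith) h0 (by ring)
  have hG := Real.Gamma_pos_of_pos hw
  rw [show (1 - θ) * w + θ * (w + 1) = w + θ by ring, Real.Gamma_add_one hw.ne',
    Real.mul_rpow hw.le hG.le, mul_comm (w ^ θ), ← mul_assoc, ← Real.rpow_add hG] at this
  simpa using this

lemma aux_gprod {x : ℝ} (hx : 0 < x) (N : ℕ) :
    ∏ k ∈ Finset.range N, (x + k) = Real.Gamma (x + N) / Real.Gamma x := by
  have hG := Real.Gamma_pos_of_pos hx
  induction N with
  | zero => simp [hG.ne']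
  | succ N ih =>
    rw [Finset.prod_range_succ, ih]; push_cast
    rw [← add_assoc, Real.Gamma_add_one (by positivity)]; ring

/-- The approximating ratios. -/
noncomputable def auxRho (α : ℝ) (N i : ℕ) : ℝ :=
  (N : ℝ) ^ (1 - α) * ∏ k ∈ Finset.range N,
    ((1 + α + k) / (1 + α) + i) / ((1 + α + k) / (1 + α) + (1 - α) / (1 + α) + i)

noncomputable def auxR (α : ℝ) (i : ℕ) : ℝ :=
  Real.Gamma ((1 + α) * i + 2) / Real.Gamma ((1 + α) * i + 1 + α)

lemma auxRho_eq {α : ℝ} (h0 : 0 < α) (N i : ℕ) :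
    auxRho α N i = auxR α i * ((N : ℝ) ^ (1 - α) *
      (Real.Gamma ((1 + α) * i + 1 + α + N) / Real.Gamma ((1 + α) * i + 2 + N))) := by
  have h2 : ∀ k : ℕ, ((1 + α + k) / (1 + α) + i) / ((1 + α + k) / (1 + α) + (1 - α) / (1 + α) + i)
      = ((1 + α) * i + 1 + α + k) / ((1 + α) * i + 2 + k) := by
    intro k
    have : 0 < 1 + α := by linarith
    have e1 : (1 + α + k) / (1 + α) + i = ((1 + α) * i + 1 + α + k) / (1 + α) := by
      field_simp; ring
    have e2 : (1 + α + k) / (1 + α) + (1 - α) / (1 + α) + i = ((1 + α) * i + 2 + k) / (1 + α) := by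
      field_simp; ring
    rw [e1, e2, div_div_div_cancel_right₀ this.ne']
  unfold auxRho auxR
  simp_rw [h2]
  rw [Finset.prod_div_distrib, aux_gprod (by positivity), aux_gprod (by positivity)]
  have := Real.Gamma_pos_of_pos (show 0 < (1 + α) * i + 1 + α by positivity)
  have := Real.Gamma_pos_of_pos (show 0 < (1 + α) * i + 2 by positivity)
  have := Real.Gamma_pos_of_pos (show 0 < (1 + α) * i + 2 + N by positivity)
  field_simp

lemma auxR_pos {α : ℝ} (h0 : 0 < α) (i : ℕ) : 0 < auxR α i :=
  div_pos (Real.Gamma_pos_of_pos (by positivity)) (Real.Gamma_pos_of_pos (by positivity))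

lemma aux_upper {α : ℝ} (h0 : 0 < α) (h1 : α < 1) (N i : ℕ) :
    (N : ℝ) ^ (1 - α) *
      (Real.Gamma ((1 + α) * i + 1 + α + N) / Real.Gamma ((1 + α) * i + 2 + N)) ≤ 1 := by
  have hw : 0 < (1 + α) * i + 1 + N := by positivity
  have h := aux_G2 hw h0 h1
  have hG := Real.Gamma_pos_of_pos hw
  have e : Real.Gamma ((1 + α) * i + 2 + N)
      = ((1 + α) * i + 1 + N) * Real.Gamma ((1 + α) * i + 1 + N) := by
    rw [← Real.Gamma_add_one hw.ne']; ring_nf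
  rw [show (1 + α) * i + 1 + α + N = (1 + α) * i + 1 + N + α by ring, e, ← mul_div_assoc,
    div_le_one (by positivity)]
  have hN : (N : ℝ) ^ (1 - α) ≤ ((1 + α) * i + 1 + N) ^ (1 - α) :=
    Real.rpow_le_rpow (by positivity) (by nlinarith [mul_nonneg (by linarith : 0 ≤ 1 + α) (Nat.cast_nonneg (α := ℝ) i)]) (by linarith)
  generalize hW : (1 + α) * i + 1 + (N : ℝ) = w at *
  calc _ ≤ w ^ (1 - α) * (Real.Gamma w * w ^ α) := by
        gcongr
    _ = w ^ (1 - α) * w ^ α * Real.Gamma w := by ring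
    _ = _ := by rw [← Real.rpow_add hw]; simp

lemma aux_lower {α : ℝ} (h0 : 0 < α) (h1 : α < 1) (N i : ℕ) :
    ((N : ℝ) / ((1 + α) * i + 1 + α + N)) ^ (1 - α) ≤ (N : ℝ) ^ (1 - α) *
      (Real.Gamma ((1 + α) * i + 1 + α + N) / Real.Gamma ((1 + α) * i + 2 + N)) := by
  have hw : 0 < (1 + α) * i + 1 + α + N := by positivity
  have h := aux_G2 (θ := 1 - α) hw (by linarith) (by linarith)
  rw [show (1 + α) * i + 1 + α + N + (1 - α) = (1 + α) * i + 2 + N by ring] at h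
  have hG := Real.Gamma_pos_of_pos (show 0 < (1 + α) * i + 2 + (N:ℝ) by positivity)
  rw [Real.div_rpow (by positivity) hw.le, div_eq_mul_inv]
  gcongr
  rw [le_div_iff₀ hG, inv_mul_le_iff₀ (by positivity)]
  linarith

lemma aux_tendsto {α : ℝ} (h0 : 0 < α) (h1 : α < 1) (i : ℕ) :
    Tendsto (fun N => auxRho α N i) atTop (𝓝 (auxR α i)) := by
  simp_rw [auxRho_eq h0]
  nth_rewrite 2 [← mul_one (auxR α i)]
  refine Tendsto.const_mul _ ?_
  refine tendsto_of_tendsto_of_tendsto_of_le_of_le (g := fun N : ℕ =>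
    ((N : ℝ) / ((1 + α) * i + 1 + α + N)) ^ (1 - α)) ?_ tendsto_const_nhds
    (fun N => aux_lower h0 h1 N i) (fun N => aux_upper h0 h1 N i)
  have h : Tendsto (fun N : ℕ => (N : ℝ) / (N + ((1 + α) * i + 1 + α))) atTop (𝓝 1) :=
    tendsto_natCast_div_add_atTop _
  have h2 := h.rpow_const (p := 1 - α) (Or.inl one_ne_zero)
  rw [Real.one_rpow] at h2
  refine h2.congr fun N => ?_
  rw [add_comm (N : ℝ)]

lemma auxRho_nonneg {α : ℝ} (h0 : 0 < α) (N i : ℕ) : 0 ≤ auxRho α N i := by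
  rw [auxRho_eq h0]
  have := auxR_pos h0 i
  have := Real.Gamma_pos_of_pos (show 0 < (1 + α) * i + 1 + α + N by positivity)
  have := Real.Gamma_pos_of_pos (show 0 < (1 + α) * i + 2 + N by positivity)
  positivity

lemma auxRho_le {α : ℝ} (h0 : 0 < α) (h1 : α < 1) (N i : ℕ) : auxRho α N i ≤ auxR α i := by
  rw [auxRho_eq h0]
  exact mul_le_of_le_one_right (auxR_pos h0 i).le (aux_upper h0 h1 N i)

lemma aux_ratio {α : ℝ} (h0 : 0 < α) (i : ℕ) :
    Real.Gamma (α * i + i + 2) / Real.Gamma (α * (i + 1) + i + 2)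
      = auxR α i / ((1 + α) * (i + 1)) := by
  unfold auxR
  rw [show α * (i + 1) + i + 2 = (1 + α) * i + 1 + α + 1 by ring,
    Real.Gamma_add_one (by positivity), show α * i + i + 2 = (1 + α) * i + 2 by ring,
    div_div, show (1 + α) * i + 1 + α = (1 + α) * (i + 1) by ring, mul_comm (Real.Gamma _)]

lemma aux_bCoef {α : ℝ} (h0 : 0 < α) (n : ℕ) :
    (1 / (n.factorial : ℝ)) * ∏ i ∈ Finset.range n, auxR α i = bCoef α n * (1 + α) ^ n := by
  unfold bCoef
  simp_rw [aux_ratio h0]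
  induction n with
  | zero => simp
  | succ n ih =>
    rw [Finset.prod_range_succ, Finset.prod_range_succ, Nat.factorial_succ]
    push_cast
    have : 0 < 1 + α := by linarith
    calc _ = (1 / (n.factorial : ℝ) * ∏ i ∈ Finset.range n, auxR α i) * (auxR α n / (n + 1)) := by
          field_simp
      _ = _ := by rw [ih]; field_simp; ring

lemma bCoef_pos {α : ℝ} (h0 : 0 < α) (n : ℕ) : 0 < bCoef α n :=
  Finset.prod_pos fun i _ => div_pos (Real.Gamma_pos_of_pos (by positivity))
    (Real.Gamma_pos_of_pos (by positivity))

lemma aux_ratio_le {α : ℝ} (h0 : 0 < α) (h1 : α < 1) (i : ℕ) :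
    Real.Gamma (α * i + i + 2) / Real.Gamma (α * (i + 1) + i + 2) ≤ ((i : ℝ) + 1) ^ (-α) := by
  have hw : 0 < (1 + α) * i + 1 + α := by positivity
  have h := aux_G2 (θ := 1 - α) hw (by linarith) (by linarith)
  have hG := Real.Gamma_pos_of_pos hw
  rw [show (1 + α) * i + 1 + α + (1 - α) = (1 + α) * i + 2 by ring] at h
  rw [aux_ratio h0, show (1 + α) * (i + 1) = (1 + α) * i + 1 + α by ring]
  have hle : (i : ℝ) + 1 ≤ (1 + α) * i + 1 + α := by
    have := mul_nonneg h0.le (Nat.cast_nonneg (α := ℝ) i); linarith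
  unfold auxR
  generalize (1 + α) * i + 1 + α = w at *
  calc _ ≤ w ^ (1 - α) / w := by
        gcongr
        rw [div_le_iff₀ hG]; linarith
    _ = w ^ (-α) := by
        nth_rewrite 2 [← Real.rpow_one w]
        rw [← Real.rpow_sub hw]; ring_nf
    _ ≤ _ := Real.rpow_le_rpow_of_nonpos (by positivity) hle (by linarith)

lemma aux_summ_b {α : ℝ} (h0 : 0 < α) (h1 : α < 1) (r : ℝ) (hr : 0 < r) :
    Summable fun n : ℕ => bCoef α n * r ^ n := by
  refine summable_of_ratio_test_tendsto_lt_one (l := 0) zero_lt_one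
    (Eventually.of_forall fun n => (mul_pos (bCoef_pos h0 n) (pow_pos hr n)).ne') ?_
  have hlim : Tendsto (fun n : ℕ => ((n : ℝ) + 1) ^ (-α) * r) atTop (𝓝 0) := by
    have := ((tendsto_rpow_neg_atTop h0).comp
      (tendsto_atTop_add_const_right _ (1:ℝ) tendsto_natCast_atTop_atTop)).mul_const r
    simpa using this
  refine squeeze_zero (fun n => by positivity) (fun n => ?_) hlim
  have hb := bCoef_pos h0 n
  rw [Real.norm_of_nonneg (mul_pos (bCoef_pos h0 _) (pow_pos hr _)).le,
    Real.norm_of_nonneg (mul_pos (bCoef_pos h0 _) (pow_pos hr _)).le]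
  have : bCoef α (n + 1) * r ^ (n + 1) / (bCoef α n * r ^ n)
      = Real.Gamma (α * n + n + 2) / Real.Gamma (α * (n + 1) + n + 2) * r := by
    have e : bCoef α (n + 1) = bCoef α n *
        (Real.Gamma (α * n + n + 2) / Real.Gamma (α * (n + 1) + n + 2)) := by
      unfold bCoef; rw [Finset.prod_range_succ]
    rw [e, pow_succ]
    generalize Real.Gamma (α * n + n + 2) / Real.Gamma (α * (n + 1) + n + 2) = q
    field_simp
  rw [this]
  gcongr
  exact aux_ratio_le h0 h1 n

lemma aux_summ_nb {α : ℝ} (h0 : 0 < α) (h1 : α < 1) (r : ℝ) (hr : 0 < r) :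
    Summable fun n : ℕ => n * bCoef α n * r ^ n := by
  refine Summable.of_nonneg_of_le (fun n => ?_) (fun n => ?_)
    (aux_summ_b h0 h1 (2 * r) (by positivity))
  · have := bCoef_pos h0 n; positivity
  · have := bCoef_pos h0 n
    have h2 : (n : ℝ) ≤ 2 ^ n := by exact_mod_cast (Nat.lt_two_pow_self (n := n)).le
    rw [mul_pow]
    calc _ = (n : ℝ) * (bCoef α n * r ^ n) := by ring
      _ ≤ 2 ^ n * (bCoef α n * r ^ n) := by gcongr
      _ = _ := by ring

lemma aux_bound {α : ℝ} (h0 : 0 < α) (h1 : α < 1) (z : ℝ) (hz : 0 < z) :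
    |∑' n : ℕ, n * bCoef α n * (-z) ^ n| ≤ 1 := by
  have hα : 0 < 1 + α := by linarith
  set y := z / (1 + α) with hy
  have hy0 : 0 < y := by positivity
  have hzy : z = (1 + α) * y := by rw [hy]; field_simp
  have hlim : Tendsto (fun N : ℕ => ∑' n : ℕ, ((n : ℝ) / n.factorial *
      ∏ i ∈ Finset.range n, auxRho α N i) * (-y) ^ n) atTop
      (𝓝 (∑' n : ℕ, ((n : ℝ) / n.factorial * ∏ i ∈ Finset.range n, auxR α i) * (-y) ^ n)) := by
    refine tendsto_tsum_of_dominated_convergence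
      (bound := fun n : ℕ => n * bCoef α n * z ^ n) (aux_summ_nb h0 h1 z hz) ?_ ?_
    · intro n
      refine Tendsto.mul_const _ (Tendsto.const_mul _ ?_)
      exact tendsto_finsetProd _ fun i _ => aux_tendsto h0 h1 i
    · refine Eventually.of_forall fun N n => ?_
      have hp : 0 ≤ ∏ i ∈ Finset.range n, auxRho α N i :=
        Finset.prod_nonneg fun i _ => auxRho_nonneg h0 N i
      rw [norm_mul, norm_pow, norm_neg, Real.norm_of_nonneg (by positivity),
        Real.norm_of_nonneg hy0.le]
      calc _ ≤ ((n : ℝ) / n.factorial * ∏ i ∈ Finset.range n, auxR α i) * y ^ n := by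
            gcongr with i hi
            · exact fun i _ => auxRho_nonneg h0 N i
            · exact auxRho_le h0 h1 N i
        _ = n * (1 / n.factorial * ∏ i ∈ Finset.range n, auxR α i) * y ^ n := by ring
        _ = _ := by rw [aux_bCoef h0, hzy, mul_pow]; ring
  have e : ∀ n : ℕ, ((n : ℝ) / n.factorial * ∏ i ∈ Finset.range n, auxR α i) * (-y) ^ n
      = n * bCoef α n * (-z) ^ n := by
    intro n
    calc _ = n * (1 / n.factorial * ∏ i ∈ Finset.range n, auxR α i) * (-y) ^ n := by ring
      _ = _ := by rw [aux_bCoef h0, hzy, ← mul_neg, mul_pow]; ring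
  simp_rw [e] at hlim
  refine le_of_tendsto hlim.abs (Eventually.of_forall fun N => ?_)
  have := aux_step (fun k => (1 + α + k) / (1 + α)) ((1 - α) / (1 + α)) (fun k => by positivity)
    (div_pos (by linarith) hα) N ((N : ℝ) ^ (1 - α) * y) (by positivity)
  refine le_of_eq_of_le (congrArg _ (tsum_congr fun n => ?_)) this
  unfold auxRho
  rw [Finset.prod_mul_distrib, ← mul_neg, mul_pow]
  simp only [Finset.prod_const, Finset.card_range]
  ring

lemma aux_deriv {α : ℝ} (h0 : 0 < α) (h1 : α < 1) (x : ℝ) (hx : 0 < x) :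
    x * deriv (Phi α) x = (1 + α) * ∑' n : ℕ, n * bCoef α n * (-(x ^ (1 + α) / (1 + α))) ^ n := by
  have hα : 0 < 1 + α := by linarith
  have hz0 : 0 < x ^ (1 + α) / (1 + α) := by positivity
  set w := -(x ^ (1 + α) / (1 + α)) with hw
  have hF : HasDerivAt (fun v : ℝ => ∑' n : ℕ, bCoef α n * v ^ n)
      (∑' n : ℕ, bCoef α n * (n * w ^ (n - 1))) w := by
    set r := |w| + 1 with hr
    have hr1 : 1 ≤ r := by rw [hr]; linarith [abs_nonneg w]
    refine hasDerivAt_tsum_of_isPreconnected (t := Metric.ball (0:ℝ) r)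
      (u := fun n : ℕ => n * bCoef α n * r ^ n) (y₀ := 0)
      (aux_summ_nb h0 h1 r (by linarith)) Metric.isOpen_ball
      (convex_ball _ _).isPreconnected (fun n v _ => (hasDerivAt_pow n v).const_mul _) ?_
      (by simp; linarith) ?_ (by simp [hr])
    · intro n v hv
      have hb := bCoef_pos h0 n
      have hv' : |v| ≤ r := by
        have := Metric.mem_ball.1 hv
        rw [Real.dist_eq, sub_zero] at this; exact this.le
      rw [norm_mul, norm_mul, norm_pow, Real.norm_of_nonneg hb.le, Real.norm_eq_abs, Real.norm_eq_abs,
        abs_of_nonneg (Nat.cast_nonneg (α := ℝ) n)]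
      calc _ = n * bCoef α n * |v| ^ (n - 1) := by ring
        _ ≤ n * bCoef α n * r ^ (n - 1) := by gcongr
        _ ≤ n * bCoef α n * r ^ n := by
          gcongr
          omega
    · exact summable_of_ne_finset_zero (s := {0}) fun n hn => by
        rw [Finset.mem_singleton] at hn; simp [hn]
  have hg : HasDerivAt (fun v : ℝ => -(v ^ (1 + α)) / (1 + α)) (-(x ^ α)) x := by
    have := ((Real.hasDerivAt_rpow_const (p := 1 + α) (Or.inl hx.ne')).neg).div_const (1 + α)
    have e : -((1 + α) * x ^ (1 + α - 1)) / (1 + α) = -(x ^ α) := by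
      rw [show 1 + α - 1 = α by ring]; field_simp
    rw [e] at this
    exact this
  have hw2 : w = -(x ^ (1 + α)) / (1 + α) := by rw [hw]; ring
  have hc : HasDerivAt (Phi α) ((∑' n : ℕ, bCoef α n * (n * w ^ (n - 1))) * -(x ^ α)) x := by
    rw [hw2] at hF ⊢
    exact HasDerivAt.comp x hF hg
  rw [hc.deriv]
  have hxw : x * -(x ^ α) = (1 + α) * w := by
    rw [hw2, Real.rpow_add hx, Real.rpow_one]; field_simp
  calc _ = (x * -(x ^ α)) * (∑' n : ℕ, bCoef α n * (n * w ^ (n - 1))) := by ring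
    _ = (1 + α) * (w * ∑' n : ℕ, bCoef α n * (n * w ^ (n - 1))) := by rw [hxw]; ring
    _ = _ := by
      rw [← tsum_mul_left]
      congr 2; ext n
      rcases n with _ | n
      · simp
      · rw [pow_succ]; simp; ring

lemma aux_C1 {α : ℝ} (h0 : 0 < α) (h1 : α < 1) : 2 ≤ C1 α := by
  have hi : IntervalIntegrable (fun u : ℝ => (1 - u) ^ (α - 1)) volume (1/2) 1 := by
    have := (intervalIntegral.intervalIntegrable_rpow' (a := 1/2) (b := 0)
      (r := α - 1) (by linarith)).comp_sub_left 1
    norm_num at this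
    norm_num
    exact this
  have hI : (1/2 : ℝ) ^ α / α ≤ ∫ u in (1/2:ℝ)..1, u ^ (-(1+α)) * (1-u) ^ (α-1) := by
    have e : ∫ u in (1/2:ℝ)..1, (1 - u) ^ (α - 1) = (1/2 : ℝ) ^ α / α := by
      rw [intervalIntegral.integral_comp_sub_left (fun u => u ^ (α - 1)),
        integral_rpow (Or.inl (by linarith))]
      norm_num [h0.ne']
    rw [← e]
    refine intervalIntegral.integral_mono_on (by norm_num) hi ?_ ?_
    · refine hi.continuousOn_mul ?_
      intro u hu
      rw [uIcc_of_le (by norm_num)] at hu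
      exact (Real.continuousAt_rpow_const _ _ (Or.inl (by linarith [hu.1]))).continuousWithinAt
    · intro u hu
      have hu0 : 0 < u := by linarith [hu.1]
      exact le_mul_of_one_le_left (Real.rpow_nonneg (by linarith [hu.2]) _)
        (Real.one_le_rpow_of_pos_of_le_one_of_nonpos hu0 hu.2 (by linarith))
  have h2 : (2:ℝ) ^ (1 + α) * (1/2 : ℝ) ^ α = 2 := by
    rw [Real.rpow_add two_pos, Real.rpow_one, mul_assoc, ← Real.mul_rpow (by norm_num) (by norm_num)]
    norm_num
  unfold C1
  calc (2:ℝ) = α * (2:ℝ) ^ (1+α) * ((1/2 : ℝ) ^ α / α) := by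
        rw [mul_assoc, mul_div_assoc', h2]; field_simp
    _ ≤ _ := by
      gcongr
      exact hI.trans (le_max_left _ _)

/-- For every `x > 1`, `|Φ′(x)| ≤ C₁(α)/x`. -/
theorem stmt7 (α : ℝ) (hα : α ∈ Set.Ioo (0:ℝ) 1) (x : ℝ) (hx : 1 < x) :
    |deriv (Phi α) x| ≤ C1 α / x := by
  obtain ⟨h0, h1⟩ := hα
  have hx0 : 0 < x := by linarith
  have hd := aux_deriv h0 h1 x hx0
  have hb := aux_bound h0 h1 (x ^ (1 + α) / (1 + α)) (by positivity)
  have hC := aux_C1 h0 h1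
  rw [le_div_iff₀ hx0, mul_comm]
  nth_rewrite 1 [← abs_of_pos hx0]
  rw [← abs_mul, hd, abs_mul, abs_of_pos (by linarith : 0 < 1 + α)]
  nlinarith
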